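/- Let 0 < ε ≤ 1/11, let G be a d-regular ε-spectral expander on 2n vertices, and suppose εn is a positive integer. Then m((1−ε)n) ≤ (2e/ε)^{εn} · d^{2εn + (4εn+2)/ln C₁(ε)} · m(n), where C₁(ε) = 1/(ε+ε²); equivalently, m((1−ε)n)/m(n) ≤ (2e/ε)^{εn} · d^{2εn + (4εn+2)/ln C₁(ε)} whenever m(n) > 0. -/

import Mathlib

open Matrix Finset

/-- The normalized adjacency matrix `Ã = A / d` of a (`d`-regular) graph. -/
noncomputable def normAdj {N : ℕ} (G : SimpleGraph (Fin N)) [DecidableRel G.Adj] (d : ℕ) :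
    Matrix (Fin N) (Fin N) ℝ :=
  (d : ℝ)⁻¹ • (SimpleGraph.adjMatrix ℝ G)

/-- `σ₂(Ã) = max(λ₂, |λ_N|)`, expressed via the Rayleigh quotient characterization:
for a `d`-regular graph the all-ones vector is a top eigenvector (with eigenvalue `λ₁ = 1`),
so `max(λ₂, |λ_N|)` is the supremum of `|xᵀ Ã x|` over unit vectors `x` orthogonal to
the all-ones vector. -/
noncomputable def sigma2 {N : ℕ} (G : SimpleGraph (Fin N)) [DecidableRel G.Adj] (d : ℕ) : ℝ :=
  sSup {r : ℝ | ∃ x : Fin N → ℝ, x ⬝ᵥ x = 1 ∧ (∑ i, x i) = 0 ∧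
    r = |x ⬝ᵥ (normAdj G d).mulVec x|}

/-- A matching in `G`: a set of edges of `G` that are pairwise disjoint. -/
def IsMatchingSet {N : ℕ} (G : SimpleGraph (Fin N)) (M : Finset (Sym2 (Fin N))) : Prop :=
  (↑M : Set (Sym2 (Fin N))) ⊆ G.edgeSet ∧
    ∀ e ∈ M, ∀ f ∈ M, e ≠ f → ∀ v : Fin N, v ∈ e → v ∉ f

/-- `m(k)`: the number of `k`-matchings of `G`. -/
noncomputable def numMatchings {N : ℕ} (G : SimpleGraph (Fin N)) (k : ℕ) : ℕ :=
  Nat.card {M : Finset (Sym2 (Fin N)) // IsMatchingSet G M ∧ M.card = k}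

section Spectral

variable {N d : ℕ} {G : SimpleGraph (Fin N)} [DecidableRel G.Adj] {ε : ℝ}

lemma abs_quadForm_normAdj_le (x : Fin N → ℝ) (hx : ∑ i, x i = 0) (hexp : sigma2 G d ≤ ε) :
    |x ⬝ᵥ (normAdj G d).mulVec x| ≤ ε * (x ⬝ᵥ x) := by
  have hbdd : BddAbove {r : ℝ | ∃ x : Fin N → ℝ, x ⬝ᵥ x = 1 ∧ (∑ i, x i) = 0 ∧
      r = |x ⬝ᵥ (normAdj G d).mulVec x|} := by
    refine ⟨∑ i, ∑ j, |normAdj G d i j|, ?_⟩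
    rintro r ⟨y, hy, -, rfl⟩
    have hy1 : ∀ i, |y i| ≤ 1 := by
      intro i
      have h : y i * y i ≤ ∑ j, y j * y j :=
        Finset.single_le_sum (f := fun j => y j * y j) (fun j _ => mul_self_nonneg _)
          (Finset.mem_univ i)
      have h2 : y i * y i ≤ 1 := h.trans_eq hy
      exact abs_le_one_iff_mul_self_le_one.mpr h2
    simp only [dotProduct, mulVec, Finset.mul_sum]
    refine (Finset.abs_sum_le_sum_abs _ _).trans (Finset.sum_le_sum fun i _ => ?_)
    refine (Finset.abs_sum_le_sum_abs _ _).trans (Finset.sum_le_sum fun j _ => ?_)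
    rw [abs_mul, abs_mul]
    have h1 : |normAdj G d i j| * |y j| ≤ |normAdj G d i j| :=
      mul_le_of_le_one_right (abs_nonneg _) (hy1 j)
    exact (mul_le_of_le_one_left (by positivity) (hy1 i)).trans h1
  by_cases h0 : x ⬝ᵥ x = 0
  · have : x = 0 := by simpa using h0
    simp [this]
  · have hpos : 0 < x ⬝ᵥ x := lt_of_le_of_ne
      (Finset.sum_nonneg fun i _ => mul_self_nonneg (x i)) (Ne.symm h0)
    have hs : 0 < √(x ⬝ᵥ x) := Real.sqrt_pos.mpr hpos
    have hsq : √(x ⬝ᵥ x) * √(x ⬝ᵥ x) = x ⬝ᵥ x := Real.mul_self_sqrt hpos.le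
    have hle := (le_csSup hbdd ⟨(√(x ⬝ᵥ x))⁻¹ • x, by
        rw [smul_dotProduct, dotProduct_smul, smul_eq_mul, smul_eq_mul]
        field_simp
        rw [sq, hsq], by
        simp [← Finset.mul_sum, hx], rfl⟩).trans hexp
    rw [mulVec_smul, smul_dotProduct, dotProduct_smul, smul_eq_mul, smul_eq_mul, ← mul_assoc,
      abs_mul, ← mul_inv, hsq, abs_of_pos (inv_pos.mpr hpos), inv_mul_le_iff₀ hpos] at hle
    linarith

lemma sq_bilinForm_normAdj_le (x y : Fin N → ℝ) (hx : ∑ i, x i = 0) (hy : ∑ i, y i = 0)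
    (hexp : sigma2 G d ≤ ε) :
    (x ⬝ᵥ (normAdj G d).mulVec y) ^ 2 ≤ ε ^ 2 * (x ⬝ᵥ x) * (y ⬝ᵥ y) := by
  have hsymm : y ⬝ᵥ (normAdj G d).mulVec x = x ⬝ᵥ (normAdj G d).mulVec y := by
    have ht : (normAdj G d)ᵀ = normAdj G d := by simp [normAdj]
    rw [dotProduct_mulVec, ← mulVec_transpose, ht, dotProduct_comm]
  set b := x ⬝ᵥ (normAdj G d).mulVec y with hb
  have key : ∀ c : ℝ, 0 ≤ (ε * (x ⬝ᵥ x)) * (c * c) + (-2 * b) * c + ε * (y ⬝ᵥ y) := by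
    intro c
    have h1 := abs_le.mp (abs_quadForm_normAdj_le (G := G) (d := d) (c • x + y)
      (by simp [Finset.sum_add_distrib, ← Finset.mul_sum, hx, hy]) hexp)
    have h2 := abs_le.mp (abs_quadForm_normAdj_le (G := G) (d := d) (c • x - y)
      (by simp [Finset.sum_sub_distrib, ← Finset.mul_sum, hx, hy]) hexp)
    have h1' := h1.2
    have h2' := h2.1
    simp only [mulVec_add, mulVec_sub, mulVec_smul, add_dotProduct, sub_dotProduct,
      dotProduct_add, dotProduct_sub, smul_dotProduct, dotProduct_smul, smul_eq_mul,
      hsymm, ← hb, dotProduct_comm y x] at h1' h2'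
    linarith
  have := discrim_le_zero key
  unfold discrim at this
  nlinarith

/-- The expander mixing bound for two vertex sets with no edge between them. -/
lemma card_mul_card_le_of_no_edges (hd : d ≠ 0) (hreg : G.IsRegularOfDegree d)
    (hexp : sigma2 G d ≤ ε) (S T : Finset (Fin N)) (hST : ∀ s ∈ S, ∀ t ∈ T, ¬ G.Adj s t) :
    (S.card : ℝ) * T.card ≤ ε ^ 2 * (N - S.card) * (N - T.card) := by
  have hSN : (S.card : ℝ) ≤ N := by exact_mod_cast (card_finset_fin_le S)
  have hTN : (T.card : ℝ) ≤ N := by exact_mod_cast (card_finset_fin_le T)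
  have hrhs : 0 ≤ ε ^ 2 * (N - S.card) * (N - T.card) := by
    have := sub_nonneg.mpr hSN
    have := sub_nonneg.mpr hTN
    positivity
  rcases S.eq_empty_or_nonempty with rfl | hS
  · simpa using hrhs
  rcases T.eq_empty_or_nonempty with rfl | hT
  · simpa using hrhs
  have hSpos : (0 : ℝ) < S.card := by exact_mod_cast hS.card_pos
  have hTpos : (0 : ℝ) < T.card := by exact_mod_cast hT.card_pos
  have hNpos : (0 : ℝ) < N := hSpos.trans_le hSN
  let ind (A : Finset (Fin N)) : Fin N → ℝ := fun i => if i ∈ A then 1 else 0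
  let one : Fin N → ℝ := fun _ => 1
  have hind1 : ∀ A, ind A ⬝ᵥ one = A.card := fun A => by simp [ind, one, dotProduct]
  have hindind : ∀ A, ind A ⬝ᵥ ind A = A.card := fun A => by simp [ind, dotProduct]
  have hone : one ⬝ᵥ one = N := by simp [one, dotProduct]
  have hAone : (normAdj G d).mulVec one = one := by
    ext i
    have h : (G.adjMatrix ℝ *ᵥ one) i = d := by
      simp [one, SimpleGraph.adjMatrix_mulVec_apply, hreg.degree_eq i]
    rw [normAdj, smul_mulVec, Pi.smul_apply, h, smul_eq_mul]
    simp [one, hd]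
  have honeA : ∀ z, one ⬝ᵥ (normAdj G d).mulVec z = one ⬝ᵥ z := by
    intro z
    have ht : (normAdj G d)ᵀ = normAdj G d := by simp [normAdj]
    rw [dotProduct_mulVec, ← mulVec_transpose, ht, hAone]
  have hSAT : ind S ⬝ᵥ (normAdj G d).mulVec (ind T) = 0 := by
    simp only [dotProduct, mulVec, Finset.mul_sum]
    refine Finset.sum_eq_zero fun i _ => Finset.sum_eq_zero fun j _ => ?_
    by_cases hi : i ∈ S
    · by_cases hj : j ∈ T
      · simp [ind, normAdj, SimpleGraph.adjMatrix_apply, hST i hi j hj]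
      · simp [ind, hj]
    · simp [ind, hi]
  have hsum : ∀ A : Finset (Fin N), ∑ i, ((N : ℝ) • ind A - (A.card : ℝ) • one) i = 0 := by
    intro A
    have h := hind1 A
    simp only [dotProduct, one, mul_one] at h
    simp only [Pi.sub_apply, Pi.smul_apply, smul_eq_mul, Finset.sum_sub_distrib, ← Finset.mul_sum, h,
      one]
    simp [mul_comm]
  have hmain := sq_bilinForm_normAdj_le (G := G) (d := d) _ _ (hsum S) (hsum T) hexp
  simp only [mulVec_sub, mulVec_smul, sub_dotProduct, dotProduct_sub, smul_dotProduct,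
    dotProduct_smul, smul_eq_mul, hSAT, hAone, honeA, hind1, hindind, hone,
    dotProduct_comm one] at hmain
  have h3 : ((N : ℝ) ^ 2 * (S.card * T.card)) * (S.card * T.card) ≤
      ((N : ℝ) ^ 2 * (S.card * T.card)) * (ε ^ 2 * (N - S.card) * (N - T.card)) := by
    nlinarith
  exact le_of_mul_le_mul_left h3 (by positivity)

end Spectral

section Slides

variable {N : ℕ} {G : SimpleGraph (Fin N)} {M : Finset (Sym2 (Fin N))}

/-- The vertex `w` is not covered by the edge set `M`. -/
def Uncovered (M : Finset (Sym2 (Fin N))) (w : Fin N) : Prop := ∀ e ∈ M, w ∉ e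

lemma IsMatchingSet.eq_of_mem (hM : IsMatchingSet G M) {e f : Sym2 (Fin N)} (he : e ∈ M)
    (hf : f ∈ M) {v : Fin N} (hve : v ∈ e) (hvf : v ∈ f) : e = f := by
  by_contra h
  exact hM.2 e he f hf h v hve hvf

lemma IsMatchingSet.mate_unique (hM : IsMatchingSet G M) {x y z : Fin N} (hy : s(x, y) ∈ M)
    (hz : s(x, z) ∈ M) : y = z :=
  Sym2.congr_right.mp (hM.eq_of_mem hy hz (Sym2.mem_mk_left _ _) (Sym2.mem_mk_left _ _))

lemma IsMatchingSet.adj (hM : IsMatchingSet G M) {x y : Fin N} (hxy : s(x, y) ∈ M) : G.Adj x y :=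
  hM.1 hxy

lemma IsMatchingSet.erase (hM : IsMatchingSet G M) (e : Sym2 (Fin N)) :
    IsMatchingSet G (M.erase e) :=
  ⟨fun _ hf => hM.1 (Finset.mem_of_mem_erase hf), fun f hf g hg =>
    hM.2 f (Finset.mem_of_mem_erase hf) g (Finset.mem_of_mem_erase hg)⟩

lemma IsMatchingSet.insert_edge (hM : IsMatchingSet G M) {u w : Fin N} (huw : G.Adj u w)
    (hu : Uncovered M u) (hw : Uncovered M w) : IsMatchingSet G (insert s(u, w) M) := by
  have haux : ∀ f ∈ M, ∀ v ∈ s(u, w), v ∉ f := by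
    intro f hf v hv
    rcases Sym2.mem_iff.mp hv with rfl | rfl
    exacts [hu f hf, hw f hf]
  refine ⟨?_, ?_⟩
  · intro e he
    rcases Finset.mem_insert.mp he with rfl | he
    · exact huw
    · exact hM.1 he
  · intro e he f hf hef v hve hvf
    rcases Finset.mem_insert.mp he with rfl | he <;> rcases Finset.mem_insert.mp hf with rfl | hf
    · exact hef rfl
    · exact haux f hf v hve hvf
    · exact haux e he v hvf hve
    · exact hM.2 e he f hf hef v hve hvf

lemma Uncovered.notMem {w : Fin N} (hw : Uncovered M w) (x : Fin N) : s(w, x) ∉ M :=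
  fun h => hw _ h (Sym2.mem_mk_left _ _)

lemma IsMatchingSet.uncovered_erase_left (hM : IsMatchingSet G M) {x y : Fin N}
    (hxy : s(x, y) ∈ M) : Uncovered (M.erase s(x, y)) x := fun _ he hx =>
  Finset.ne_of_mem_erase he
    (hM.eq_of_mem (Finset.mem_of_mem_erase he) hxy hx (Sym2.mem_mk_left _ _))

lemma IsMatchingSet.uncovered_erase_right (hM : IsMatchingSet G M) {x y : Fin N}
    (hxy : s(x, y) ∈ M) : Uncovered (M.erase s(x, y)) y := fun _ he hx =>
  Finset.ne_of_mem_erase he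
    (hM.eq_of_mem (Finset.mem_of_mem_erase he) hxy hx (Sym2.mem_mk_right _ _))

lemma Uncovered.erase {w : Fin N} (hw : Uncovered M w) (e : Sym2 (Fin N)) :
    Uncovered (M.erase e) w := fun f hf => hw f (Finset.mem_of_mem_erase hf)

lemma Uncovered.insert_edge {w x y : Fin N} (hw : Uncovered M w) (hx : w ≠ x) (hy : w ≠ y) :
    Uncovered (insert s(x, y) M) w := by
  intro f hf
  rcases Finset.mem_insert.mp hf with rfl | hf
  · simp [hx, hy]
  · exact hw f hf

open Classical in
/-- Slide the uncovered vertex `w` through `x`: if `xy ∈ M`, replace `xy` by `wx`, which leaves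
`y` uncovered; if `x` is uncovered, nothing changes. -/
noncomputable def slideStep (M : Finset (Sym2 (Fin N))) (w x : Fin N) :
    Finset (Sym2 (Fin N)) × Fin N :=
  if h : ∃ y, s(x, y) ∈ M then (insert s(w, x) (M.erase s(x, h.choose)), h.choose) else (M, w)

lemma slideStep_of_uncovered {w x : Fin N} (hx : Uncovered M x) : slideStep M w x = (M, w) :=
  dif_neg fun ⟨y, hy⟩ => hx.notMem y hy

lemma IsMatchingSet.slideStep_eq (hM : IsMatchingSet G M) {w x y : Fin N} (hxy : s(x, y) ∈ M) :
    slideStep M w x = (insert s(w, x) (M.erase s(x, y)), y) := by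
  have h : ∃ y, s(x, y) ∈ M := ⟨y, hxy⟩
  rw [slideStep, dif_pos h, ← hM.mate_unique hxy h.choose_spec]

/-- Sliding an uncovered vertex gives a matching of the same size, and can be undone by sliding
back. -/
lemma IsMatchingSet.slide (hM : IsMatchingSet G M) {w x y : Fin N} (hw : Uncovered M w)
    (hwx : G.Adj w x) (hxy : s(x, y) ∈ M) :
    IsMatchingSet G (insert s(w, x) (M.erase s(x, y))) ∧
      (insert s(w, x) (M.erase s(x, y))).card = M.card ∧
      Uncovered (insert s(w, x) (M.erase s(x, y))) y ∧
      slideStep (insert s(w, x) (M.erase s(x, y))) y x = (M, w) := by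
  have hyw : y ≠ w := by
    rintro rfl
    exact hw _ hxy (Sym2.mem_mk_right _ _)
  have hM' := (hM.erase s(x, y)).insert_edge hwx (hw.erase _) (hM.uncovered_erase_left hxy)
  have hnot : s(w, x) ∉ M.erase s(x, y) := (hw.erase _).notMem x
  refine ⟨hM', ?_, (hM.uncovered_erase_right hxy).insert_edge hyw (hM.adj hxy).ne', ?_⟩
  · rw [Finset.card_insert_of_notMem hnot, Finset.card_erase_add_one hxy]
  · have hmem : s(x, w) ∈ insert s(w, x) (M.erase s(x, y)) := by
      rw [Sym2.eq_swap]; exact Finset.mem_insert_self _ _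
    rw [hM'.slideStep_eq hmem, Sym2.eq_swap (a := x) (b := w), Finset.erase_insert hnot,
      Sym2.eq_swap (a := y), Finset.insert_erase hxy]

variable [DecidableRel G.Adj]

variable (G) in
/-- The states that are reached from a given one by `t` slides along edges of `G`. -/
noncomputable def slideSet :
    ℕ → Finset (Sym2 (Fin N)) × Fin N → Finset (Finset (Sym2 (Fin N)) × Fin N)
  | 0, p => {p}
  | t + 1, p => (G.neighborFinset p.2).biUnion fun x => slideSet t (slideStep p.1 p.2 x)

lemma card_slideSet_le {d : ℕ} (hreg : G.IsRegularOfDegree d) (t : ℕ)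
    (p : Finset (Sym2 (Fin N)) × Fin N) : (slideSet G t p).card ≤ d ^ t := by
  induction t generalizing p with
  | zero => simp [slideSet]
  | succ t ih =>
    rw [slideSet, pow_succ', ← hreg.degree_eq p.2, ← G.card_neighborFinset_eq_degree]
    refine Finset.card_biUnion_le_card_mul _ _ _ fun x _ => ?_
    rw [G.card_neighborFinset_eq_degree, hreg.degree_eq p.2]
    exact ih _

lemma slideSet_subset_succ {w x : Fin N} (hwx : G.Adj w x) (hx : Uncovered M x) (t : ℕ) :
    slideSet G t (M, w) ⊆ slideSet G (t + 1) (M, w) := by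
  intro q hq
  rw [slideSet, Finset.mem_biUnion]
  exact ⟨x, by simpa using hwx, by rwa [slideStep_of_uncovered hx]⟩

lemma slideSet_subset {w x : Fin N} (hwx : G.Adj w x) (hx : Uncovered M x) {t l : ℕ}
    (htl : t ≤ l) : slideSet G t (M, w) ⊆ slideSet G l (M, w) := by
  induction l, htl using Nat.le_induction with
  | base => exact subset_rfl
  | succ l _ ih => exact ih.trans (slideSet_subset_succ hwx hx l)

lemma mem_slideSet_slide (hM : IsMatchingSet G M) {w x y : Fin N} (hw : Uncovered M w)
    (hwx : G.Adj w x) (hxy : s(x, y) ∈ M) {t : ℕ} {q : Finset (Sym2 (Fin N)) × Fin N}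
    (hq : q ∈ slideSet G t (M, w)) :
    q ∈ slideSet G (t + 1) (insert s(w, x) (M.erase s(x, y)), y) := by
  rw [slideSet, Finset.mem_biUnion]
  refine ⟨x, by simpa using (hM.adj hxy).symm, ?_⟩
  rwa [(hM.slide hw hwx hxy).2.2.2]

end Slides

section Forests

variable {N : ℕ} {G : SimpleGraph (Fin N)} {M : Finset (Sym2 (Fin N))} {R : Finset (Fin N)}

lemma mem_right_of_eq {m : Sym2 (Fin N)} {x y : Fin N} (h : m = s(x, y)) : y ∈ m :=
  h ▸ Sym2.mem_mk_right x y

/-- `AltForest G M R i E V`: there is a forest of `M`-alternating paths with root set `R` and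
depth at most `i`, whose vertex set is `V` and whose vertices at even distance from the roots
are those in `E`. In each round, every edge in `A` is attached to some vertex of `E`, and its far
end `far m` joins the even vertices. -/
inductive AltForest (G : SimpleGraph (Fin N)) (M : Finset (Sym2 (Fin N))) (R : Finset (Fin N)) :
    ℕ → Finset (Fin N) → Finset (Fin N) → Prop
  | root : AltForest G M R 0 R R
  | grow {i : ℕ} {E V : Finset (Fin N)} (A : Finset (Sym2 (Fin N))) (far : Sym2 (Fin N) → Fin N) :
      AltForest G M R i E V → A ⊆ M → (∀ m ∈ A, ∀ z ∈ m, z ∉ V) →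
      (∀ m ∈ A, ∃ x, m = s(x, far m) ∧ ∃ p ∈ E, G.Adj p x) →
      AltForest G M R (i + 1) (E ∪ A.image far) (V ∪ A.biUnion Sym2.toFinset)

namespace AltForest

variable {i : ℕ} {E V : Finset (Fin N)}

lemma roots_subset (h : AltForest G M R i E V) : R ⊆ E := by
  induction h with
  | root => exact subset_rfl
  | grow A far _ _ _ _ ih => exact ih.trans Finset.subset_union_left

lemma even_subset (h : AltForest G M R i E V) : E ⊆ V := by
  induction h with
  | root => exact subset_rfl
  | grow A far _ _ _ hA ih =>
    refine Finset.union_subset_union ih fun y hy => ?_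
    obtain ⟨m, hm, rfl⟩ := Finset.mem_image.mp hy
    obtain ⟨x, hx, -⟩ := hA m hm
    exact Finset.mem_biUnion.mpr ⟨m, hm, Sym2.mem_toFinset.mpr (mem_right_of_eq hx)⟩

lemma closed (h : AltForest G M R i E V) (hM : IsMatchingSet G M) (hR : ∀ u ∈ R, Uncovered M u)
    {m : Sym2 (Fin N)} (hm : m ∈ M) {z z' : Fin N} (hz : z ∈ m) (hz' : z' ∈ m) (hzV : z ∈ V) :
    z' ∈ V := by
  induction h with
  | root => exact absurd hz (hR z hzV m hm)
  | grow A far _ hAM _ _ ih =>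
    rcases Finset.mem_union.mp hzV with hzV | hzA
    · exact Finset.mem_union_left _ (ih hzV)
    · obtain ⟨m', hm', hzm'⟩ := Finset.mem_biUnion.mp hzA
      obtain rfl := hM.eq_of_mem hm (hAM hm') hz (Sym2.mem_toFinset.mp hzm')
      exact Finset.mem_union_right _
        (Finset.mem_biUnion.mpr ⟨m, hm', Sym2.mem_toFinset.mpr hz'⟩)

lemma far_injOn (hM : IsMatchingSet G M) {A : Finset (Sym2 (Fin N))} (hAM : A ⊆ M)
    {far : Sym2 (Fin N) → Fin N} (hA : ∀ m ∈ A, far m ∈ m) : Set.InjOn far A := by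
  intro m hm m' hm' heq
  exact hM.eq_of_mem (hAM hm) (hAM hm') (hA m hm) (heq ▸ hA m' hm')

end AltForest

lemma IsMatchingSet.card_biUnion (hM : IsMatchingSet G M) {A : Finset (Sym2 (Fin N))}
    (hAM : A ⊆ M) : (A.biUnion Sym2.toFinset).card = 2 * A.card := by
  rw [Finset.card_biUnion, Finset.sum_const_nat (m := 2), mul_comm]
  · intro m hm
    exact Sym2.card_toFinset_of_not_isDiag m (G.not_isDiag_of_mem_edgeSet (hM.1 (hAM hm)))
  · intro m hm m' hm' hne
    rw [Function.onFun, Finset.disjoint_left]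
    intro z hz hz'
    exact hM.2 m (hAM hm) m' (hAM hm') hne z (Sym2.mem_toFinset.mp hz) (Sym2.mem_toFinset.mp hz')

namespace AltForest

variable {i : ℕ} {E V : Finset (Fin N)}

lemma card_even_grow (h : AltForest G M R i E V) (hM : IsMatchingSet G M)
    {A : Finset (Sym2 (Fin N))} (hAM : A ⊆ M) (hAV : ∀ m ∈ A, ∀ z ∈ m, z ∉ V)
    {far : Sym2 (Fin N) → Fin N} (hA : ∀ m ∈ A, far m ∈ m) :
    (E ∪ A.image far).card = E.card + A.card := by
  rw [Finset.card_union_of_disjoint, Finset.card_image_of_injOn (far_injOn hM hAM hA)]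
  rw [Finset.disjoint_left]
  intro z hz hz'
  obtain ⟨m, hm, rfl⟩ := Finset.mem_image.mp hz'
  exact hAV m hm _ (hA m hm) (h.even_subset hz)

lemma card_add (h : AltForest G M R i E V) (hM : IsMatchingSet G M) :
    V.card + R.card = 2 * E.card := by
  induction h with
  | root => ring
  | @grow i E V A far h hAM hAV hA ih =>
    have hfar : ∀ m ∈ A, far m ∈ m := by
      intro m hm
      obtain ⟨x, hx, -⟩ := hA m hm
      exact mem_right_of_eq hx
    have hdisj : Disjoint V (A.biUnion Sym2.toFinset) := by
      rw [Finset.disjoint_left]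
      intro z hz hz'
      obtain ⟨m, hm, hzm⟩ := Finset.mem_biUnion.mp hz'
      exact hAV m hm z (Sym2.mem_toFinset.mp hzm) hz
    rw [h.card_even_grow hM hAM hAV hfar, Finset.card_union_of_disjoint hdisj,
      hM.card_biUnion hAM]
    omega

variable [DecidableRel G.Adj]

/-- Each even vertex of an alternating forest is reached from a root by sliding inside the
forest. -/
lemma exists_slide_to (h : AltForest G M R i E V) (hM : IsMatchingSet G M)
    (hR : ∀ u ∈ R, Uncovered M u) {f : Fin N} (hf : f ∈ E) :
    ∃ v, ∃ t ≤ i, ∃ M', IsMatchingSet G M' ∧ M'.card = M.card ∧ Uncovered M' f ∧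
      (∀ z ∉ V, ∀ m : Sym2 (Fin N), z ∈ m → (m ∈ M' ↔ m ∈ M)) ∧
      (M, v) ∈ slideSet G t (M', f) := by
  induction h generalizing f with
  | root => exact ⟨f, 0, le_rfl, M, hM, rfl, hR f hf, by simp, by simp [slideSet]⟩
  | @grow i E V A far h hAM hAV hA ih =>
    rcases Finset.mem_union.mp hf with hf | hf
    · obtain ⟨v, t, ht, M', h1, h2, h3, h4, h5⟩ := ih hf
      exact ⟨v, t, by omega, M', h1, h2, h3,
        fun z hz => h4 z fun hz' => hz (Finset.mem_union_left _ hz'), h5⟩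
    · obtain ⟨m, hm, rfl⟩ := Finset.mem_image.mp hf
      obtain ⟨x, hx, p, hp, hpx⟩ := hA m hm
      obtain ⟨v, t, ht, M', h1, h2, h3, h4, h5⟩ := ih hp
      have hxm : x ∈ m := by rw [hx]; exact Sym2.mem_mk_left _ _
      have hxy : s(x, far m) ∈ M' := by
        rw [← hx]
        exact (h4 x (hAV m hm x hxm) m hxm).mpr (hAM hm)
      obtain ⟨k1, k2, k3, -⟩ := h1.slide h3 hpx hxy
      refine ⟨v, t + 1, by omega, _, k1, k2.trans h2, k3, ?_,
        mem_slideSet_slide h1 h3 hpx hxy h5⟩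
      intro z hz m' hzm'
      rw [Finset.mem_union, not_or] at hz
      have hzm : z ∉ m := fun hzm =>
        hz.2 (Finset.mem_biUnion.mpr ⟨m, hm, Sym2.mem_toFinset.mpr hzm⟩)
      have hne1 : m' ≠ s(x, far m) := by
        rintro rfl
        exact hzm (hx ▸ hzm')
      have hne2 : m' ≠ s(p, x) := by
        rintro rfl
        rcases Sym2.mem_iff.mp hzm' with rfl | rfl
        · exact hz.1 (h.even_subset hp)
        · exact hzm hxm
      rw [Finset.mem_insert, Finset.mem_erase]
      simp only [hne1, hne2, false_or, ne_eq, not_false_eq_true, true_and]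
      exact h4 z hz.1 m' hzm'

/-- An uncovered vertex outside an alternating forest that is adjacent to an even vertex can be
slid inside the forest until it is adjacent to a root. -/
lemma exists_slide_from (h : AltForest G M R i E V)
    (hR : ∀ u ∈ R, Uncovered M u) {e : Fin N} (he : e ∈ E)
    {q : Finset (Sym2 (Fin N)) × Fin N} {t₀ : ℕ} {M₁ : Finset (Sym2 (Fin N))} {w : Fin N}
    (hM₁ : IsMatchingSet G M₁) (hw : Uncovered M₁ w) (hwV : w ∉ V) (hwe : G.Adj w e)
    (hagree : ∀ z ∈ V, ∀ m : Sym2 (Fin N), z ∈ m → (m ∈ M₁ ↔ m ∈ M))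
    (hq : q ∈ slideSet G t₀ (M₁, w)) :
    ∃ u ∈ R, ∃ t ≤ t₀ + i, ∃ M' w', IsMatchingSet G M' ∧ M'.card = M₁.card ∧
      Uncovered M' w' ∧ Uncovered M' u ∧ G.Adj w' u ∧ q ∈ slideSet G t (M', w') := by
  induction h generalizing e M₁ w t₀ with
  | root =>
    exact ⟨e, he, t₀, le_rfl, M₁, w, hM₁, rfl, hw,
      fun m hm hem => hR e he m ((hagree e he m hem).mp hm) hem, hwe, hq⟩
  | @grow i E V A far h hAM hAV hA ih =>
    have hwV' : w ∉ V := fun hw' => hwV (Finset.mem_union_left _ hw')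
    have hagree' : ∀ z ∈ V, ∀ m : Sym2 (Fin N), z ∈ m → (m ∈ M₁ ↔ m ∈ M) :=
      fun z hz => hagree z (Finset.mem_union_left _ hz)
    rcases Finset.mem_union.mp he with he | he
    · obtain ⟨u, hu, t, ht, rest⟩ := ih he hM₁ hw hwV' hwe hagree' hq
      exact ⟨u, hu, t, by omega, rest⟩
    · obtain ⟨m, hm, rfl⟩ := Finset.mem_image.mp he
      obtain ⟨x, hx, p, hp, hpx⟩ := hA m hm
      have hxm : x ∈ m := by rw [hx]; exact Sym2.mem_mk_left _ _
      have hym : far m ∈ m := mem_right_of_eq hx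
      have hyx : s(far m, x) ∈ M₁ := by
        rw [Sym2.eq_swap, ← hx]
        exact (hagree x (Finset.mem_union_right _
          (Finset.mem_biUnion.mpr ⟨m, hm, Sym2.mem_toFinset.mpr hxm⟩)) m hxm).mpr (hAM hm)
      obtain ⟨k1, k2, k3, -⟩ := hM₁.slide hw hwe hyx
      obtain ⟨u, hu, t, ht, M', w', h1, h2, h3⟩ := ih hp k1 k3 (hAV m hm x hxm) hpx.symm (by
        intro z hz m' hzm'
        have hne1 : m' ≠ s(far m, x) := by
          rintro rfl
          rw [Sym2.eq_swap, ← hx] at hzm'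
          exact hAV m hm z hzm' hz
        have hne2 : m' ≠ s(w, far m) := by
          rintro rfl
          rcases Sym2.mem_iff.mp hzm' with rfl | rfl
          · exact hwV' hz
          · exact hAV m hm _ hym hz
        rw [Finset.mem_insert, Finset.mem_erase]
        simp only [hne1, hne2, false_or, ne_eq, not_false_eq_true, true_and]
        exact hagree' z hz m' hzm') (mem_slideSet_slide hM₁ hw hwe hyx hq)
      exact ⟨u, hu, t, by omega, M', w', h1, h2.trans k2, h3⟩

end AltForest

end Forests

section Growth

variable {N : ℕ} {G : SimpleGraph (Fin N)} {M : Finset (Sym2 (Fin N))} {R₁ R₂ : Finset (Fin N)}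

open Classical in
/-- The vertices adjacent to some vertex of `S`. -/
noncomputable def nbhd (G : SimpleGraph (Fin N)) (S : Finset (Fin N)) : Finset (Fin N) :=
  Finset.univ.filter fun t => ∃ s ∈ S, G.Adj s t

lemma mem_nbhd {S : Finset (Fin N)} {t : Fin N} : t ∈ nbhd G S ↔ ∃ s ∈ S, G.Adj s t := by
  simp [nbhd]

lemma card_mul_le_card_nbhd_mul {ε : ℝ}
    (hmix : ∀ S T : Finset (Fin N), (∀ s ∈ S, ∀ t ∈ T, ¬ G.Adj s t) →
      (S.card : ℝ) * T.card ≤ ε ^ 2 * (N - S.card) * (N - T.card)) (S : Finset (Fin N)) :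
    (S.card : ℝ) * N ≤ (nbhd G S).card * (ε ^ 2 * N + S.card) := by
  have h := hmix S (nbhd G S)ᶜ fun s hs t ht hst =>
    Finset.mem_compl.mp ht (mem_nbhd.mpr ⟨s, hs, hst⟩)
  have hc : ((nbhd G S)ᶜ.card : ℝ) = N - (nbhd G S).card := by
    rw [Finset.card_compl, Fintype.card_fin, Nat.cast_sub (card_finset_fin_le _)]
  rw [hc] at h
  have : 0 ≤ ε ^ 2 * S.card * (nbhd G S).card := by positivity
  nlinarith

lemma AltForest.exists_new_edges {i i' : ℕ} {E VE F VF : Finset (Fin N)}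
    (hE : AltForest G M R₁ i E VE) (hF : AltForest G M R₂ i' F VF) (hM : IsMatchingSet G M)
    (hR₁ : ∀ u ∈ R₁, Uncovered M u) (hR₂ : ∀ u ∈ R₂, Uncovered M u)
    (hcov : ∀ w, Uncovered M w → w ∈ R₁ ∨ w ∈ R₂) (hno : ∀ e ∈ E, ∀ f ∈ F, ¬ G.Adj e f) :
    ∃ A ⊆ M, (∀ m ∈ A, ∀ z ∈ m, z ∉ VE ∧ z ∉ VF) ∧
      (∀ m ∈ A, ∃ y x, m = s(x, y) ∧ ∃ p ∈ E, G.Adj p x) ∧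
      (nbhd G E).card + R₁.card + R₂.card ≤ 2 * A.card + 2 * E.card + F.card := by
  classical
  let Z := nbhd G E \ (VE ∪ VF)
  let A := M.filter fun m => ∃ z ∈ m, z ∈ Z
  have hAM : A ⊆ M := Finset.filter_subset _ _
  refine ⟨A, hAM, ?_, ?_, ?_⟩
  · intro m hm z hz
    obtain ⟨hmM, z', hz', hz'Z⟩ := Finset.mem_filter.mp hm
    have hnot : z' ∉ VE ∧ z' ∉ VF := by simpa using (Finset.mem_sdiff.mp hz'Z).2
    exact ⟨fun h => hnot.1 (hE.closed hM hR₁ hmM hz hz' h),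
      fun h => hnot.2 (hF.closed hM hR₂ hmM hz hz' h)⟩
  · intro m hm
    obtain ⟨-, x, hx, hxZ⟩ := Finset.mem_filter.mp hm
    obtain ⟨y, hy⟩ := Sym2.mem_iff_exists.mp hx
    exact ⟨y, x, hy, mem_nbhd.mp (Finset.mem_sdiff.mp hxZ).1⟩
  · have hZ : Z ⊆ A.biUnion Sym2.toFinset := by
      intro z hz
      have hnot : z ∉ VE ∧ z ∉ VF := by simpa using (Finset.mem_sdiff.mp hz).2
      have hzc : ¬ Uncovered M z := by
        intro h
        rcases hcov z h with h | h
        · exact hnot.1 (hE.even_subset (hE.roots_subset h))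
        · exact hnot.2 (hF.even_subset (hF.roots_subset h))
      simp only [Uncovered, not_forall, not_not] at hzc
      obtain ⟨m, hm, hzm⟩ := hzc
      exact Finset.mem_biUnion.mpr
        ⟨m, Finset.mem_filter.mpr ⟨hm, z, hzm, hz⟩, Sym2.mem_toFinset.mpr hzm⟩
    have hZc := (Finset.card_le_card hZ).trans_eq (hM.card_biUnion hAM)
    have hsub : nbhd G E ⊆ VE ∪ (VF \ F) ∪ Z := by
      intro t ht
      have htF : t ∉ F := by
        obtain ⟨e, he, het⟩ := mem_nbhd.mp ht
        exact fun h => hno e he t h het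
      simp only [Z, Finset.mem_union, Finset.mem_sdiff]
      tauto
    have h1 := Finset.card_le_card hsub
    have h2 := Finset.card_union_le (VE ∪ (VF \ F)) Z
    have h3 := Finset.card_union_le VE (VF \ F)
    have h4 := Finset.card_sdiff_add_card_eq_card hF.even_subset
    have h5 := hE.card_add hM
    have h6 := hF.card_add hM
    omega

lemma AltForest.exists_grow {i : ℕ} {R E V : Finset (Fin N)} (h : AltForest G M R i E V)
    (hM : IsMatchingSet G M) {A : Finset (Sym2 (Fin N))} (hAM : A ⊆ M)
    (hAV : ∀ m ∈ A, ∀ z ∈ m, z ∉ V)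
    (hA : ∀ m ∈ A, ∃ y x, m = s(x, y) ∧ ∃ p ∈ E, G.Adj p x) :
    ∃ E', AltForest G M R (i + 1) E' (V ∪ A.biUnion Sym2.toFinset) ∧
      E'.card = E.card + A.card := by
  classical
  let far : Sym2 (Fin N) → Fin N := fun m =>
    if h : ∃ y x, m = s(x, y) ∧ ∃ p ∈ E, G.Adj p x then h.choose else m.out.1
  have hfar : ∀ m ∈ A, ∃ x, m = s(x, far m) ∧ ∃ p ∈ E, G.Adj p x := by
    intro m hm
    have h := (hA m hm).choose_spec
    simpa only [far, dif_pos (hA m hm)] using h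
  refine ⟨_, AltForest.grow A far h hAM hAV hfar, h.card_even_grow hM hAM hAV fun m hm => ?_⟩
  obtain ⟨x, hx, -⟩ := hfar m hm
  exact mem_right_of_eq hx

/-- Two disjoint alternating forests with equally many even vertices and no edge between these
can both be grown by one round while staying disjoint. -/
lemma AltForest.exists_grow_pair {i : ℕ} {E VE F VF : Finset (Fin N)}
    (hE : AltForest G M R₁ i E VE) (hF : AltForest G M R₂ i F VF) (hM : IsMatchingSet G M)
    (hR₁ : ∀ u ∈ R₁, Uncovered M u) (hR₂ : ∀ u ∈ R₂, Uncovered M u)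
    (hcov : ∀ w, Uncovered M w → w ∈ R₁ ∨ w ∈ R₂) (hno : ∀ e ∈ E, ∀ f ∈ F, ¬ G.Adj e f)
    (hdisj : Disjoint VE VF) (hcard : E.card = F.card) (hpos₁ : 0 < R₁.card)
    (hpos₂ : 0 < R₂.card) :
    ∃ E' VE' F' VF', AltForest G M R₁ (i + 1) E' VE' ∧ AltForest G M R₂ (i + 1) F' VF' ∧
      Disjoint VE' VF' ∧ E'.card = F'.card ∧
      ((nbhd G E).card + E.card ≤ 4 * E'.card ∨ (nbhd G F).card + E.card ≤ 4 * E'.card) := by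
  classical
  obtain ⟨A, hAM, hAV, hAE, hAc⟩ := hE.exists_new_edges hF hM hR₁ hR₂ hcov hno
  obtain ⟨B, hBM, hBV, hBF, hBc⟩ := hF.exists_new_edges hE hM hR₂ hR₁
    (fun w hw => (hcov w hw).symm) (fun f hf e he hfe => hno e he f hf hfe.symm)
  let y := min A.card B.card / 2
  obtain ⟨A', hA'A, hA'c⟩ := Finset.exists_subset_card_eq (show y ≤ A.card by omega)
  obtain ⟨B', hB'B, hB'c⟩ := Finset.exists_subset_card_eq
    (show y ≤ (B \ A').card by
      have := Finset.le_card_sdiff A' B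
      omega)
  have hB'B₀ : B' ⊆ B := hB'B.trans Finset.sdiff_subset
  obtain ⟨E', hE', hE'c⟩ := hE.exists_grow hM (hA'A.trans hAM)
    (fun m hm z hz => (hAV m (hA'A hm) z hz).1) (fun m hm => hAE m (hA'A hm))
  obtain ⟨F', hF', hF'c⟩ := hF.exists_grow hM (hB'B₀.trans hBM)
    (fun m hm z hz => (hBV m (hB'B₀ hm) z hz).1) (fun m hm => hBF m (hB'B₀ hm))
  refine ⟨E', _, F', _, hE', hF', ?_, by omega, by omega⟩
  rw [Finset.disjoint_left]
  intro z hz hz'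
  rcases Finset.mem_union.mp hz with hz | hz <;> rcases Finset.mem_union.mp hz' with hz' | hz'
  · exact Finset.disjoint_left.mp hdisj hz hz'
  · obtain ⟨m, hm, hzm⟩ := Finset.mem_biUnion.mp hz'
    exact (hBV m (hB'B₀ hm) z (Sym2.mem_toFinset.mp hzm)).2 hz
  · obtain ⟨m, hm, hzm⟩ := Finset.mem_biUnion.mp hz
    exact (hAV m (hA'A hm) z (Sym2.mem_toFinset.mp hzm)).2 hz'
  · obtain ⟨m, hm, hzm⟩ := Finset.mem_biUnion.mp hz
    obtain ⟨m', hm', hzm'⟩ := Finset.mem_biUnion.mp hz'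
    obtain rfl := hM.eq_of_mem (hAM (hA'A hm)) (hBM (hB'B₀ hm')) (Sym2.mem_toFinset.mp hzm)
      (Sym2.mem_toFinset.mp hzm')
    exact (Finset.mem_sdiff.mp (hB'B hm')).2 hm

/-- Bounds for the growth factor `Q = √C₁`, where `C₁ = 1 / (ε + ε²)`. -/
lemma growth_factor_bounds {ε Q : ℝ} (hε0 : 0 < ε) (hε : ε ≤ 1 / 11) (hQ0 : 0 < Q)
    (hQ : Q ^ 2 * (ε + ε ^ 2) = 1) :
    1 ≤ Q ∧ Q * (2 * ε * (1 + 2 * ε)) ≤ 1 ∧ 4 * ε * (1 + 2 * (ε * Q)) ≤ 1 := by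
  have hs : ε + ε ^ 2 ≤ 1 := by nlinarith
  refine ⟨?_, ?_, ?_⟩
  · by_contra! h
    have : Q ^ 2 < 1 := by nlinarith
    nlinarith [sq_nonneg Q]
  · rw [← sq_le_one_iff₀ (by positivity)]
    have h1 : (2 * ε * (1 + 2 * ε)) ^ 2 ≤ ε + ε ^ 2 := by
      have : (1 + 2 * ε) ^ 2 ≤ 2 := by nlinarith
      nlinarith
    calc (Q * (2 * ε * (1 + 2 * ε))) ^ 2 = Q ^ 2 * (2 * ε * (1 + 2 * ε)) ^ 2 := by ring
      _ ≤ Q ^ 2 * (ε + ε ^ 2) := by gcongr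
      _ = 1 := hQ
  · have h1 : (ε * Q) ^ 2 ≤ 1 / 11 := by
      have : (ε * Q) ^ 2 * (1 + ε) = ε := by linear_combination ε * hQ
      nlinarith [sq_nonneg (ε * Q)]
    have h2 : ε * Q ≤ 1 / 3 := by
      have : 0 < ε * Q := by positivity
      nlinarith
    have h3 : 1 + 2 * (ε * Q) ≤ 5 / 3 := by linarith
    calc 4 * ε * (1 + 2 * (ε * Q)) ≤ 4 * (1 / 11) * (5 / 3) := by gcongr
      _ ≤ 1 := by norm_num

lemma growth_step {ε Q k x y ν a : ℝ} (hε0 : 0 < ε) (hε : ε ≤ 1 / 11) (hQ0 : 0 < Q)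
    (hQ : Q ^ 2 * (ε + ε ^ 2) = 1) (hk : 0 < k) (hx : 0 < x) (hν : 0 ≤ ν)
    (hexp : x * (2 * k) ≤ ν * (ε * (2 * ε * k + x))) (hy : ν + x ≤ 4 * y) :
    (min a k ≤ x → min (a * Q) k ≤ y) ∧ (k / Q ≤ x → 2 * k ≤ y) := by
  obtain ⟨-, h2, h3⟩ := growth_factor_bounds hε0 hε hQ0 hQ
  have hδ : 0 < 2 * ε * (1 + 2 * ε) := by positivity
  have hδ1 : 2 * ε * (1 + 2 * ε) ≤ 1 := by nlinarith
  have hνy : ν ≤ 4 * y := by linarith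
  have hy0 : 0 ≤ y := by linarith
  refine ⟨fun h => ?_, fun h => ?_⟩
  · rcases le_total x k with hxk | hkx
    · have h4 : x ≤ y * (2 * ε * (1 + 2 * ε)) := by
        have : ν * (ε * (2 * ε * k + x)) ≤ (4 * y) * (ε * (2 * ε * k + k)) := by gcongr
        have : x * (2 * k) ≤ (y * (2 * ε * (1 + 2 * ε))) * (2 * k) := by linarith
        exact le_of_mul_le_mul_right this (by positivity)
      have h5 : x * Q ≤ y := by
        calc x * Q ≤ (y * (2 * ε * (1 + 2 * ε))) * Q := by gcongr
          _ = y * (Q * (2 * ε * (1 + 2 * ε))) := by ring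
          _ ≤ y := mul_le_of_le_one_right hy0 h2
      rcases min_le_iff.mp h with h | h
      · exact (min_le_left _ _).trans ((mul_le_mul_of_nonneg_right h hQ0.le).trans h5)
      · obtain rfl := le_antisymm h hxk
        refine (min_le_right _ _).trans (h4.trans (mul_le_of_le_one_right hy0 hδ1))
    · have h4 : k ≤ y * (2 * ε * (1 + 2 * ε)) := by
        have : ν * (ε * (2 * ε * k + x)) ≤ (4 * y) * (ε * (2 * ε * x + x)) := by gcongr
        have : k * (2 * x) ≤ (y * (2 * ε * (1 + 2 * ε))) * (2 * x) := by linarith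
        exact le_of_mul_le_mul_right this (by positivity)
      exact (min_le_right _ _).trans (h4.trans (mul_le_of_le_one_right hy0 hδ1))
  · have hkQ : k ≤ x * Q := (div_le_iff₀ hQ0).mp h
    have h4 : 2 * k ≤ y * (4 * ε * (1 + 2 * (ε * Q))) := by
      have : ν * (ε * (2 * ε * k + x)) ≤ (4 * y) * (ε * (2 * ε * (x * Q) + x)) := by gcongr
      have : (2 * k) * x ≤ (y * (4 * ε * (1 + 2 * (ε * Q)))) * x := by linarith
      exact le_of_mul_le_mul_right this hx
    exact h4.trans (mul_le_of_le_one_right hy0 h3)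

lemma exists_adjacent_forests {n j k r : ℕ} {ε Q : ℝ} {G : SimpleGraph (Fin (2 * n))}
    {M : Finset (Sym2 (Fin (2 * n)))} {R₁ R₂ : Finset (Fin (2 * n))}
    (hε0 : 0 < ε) (hε : ε ≤ 1 / 11) (hQ0 : 0 < Q) (hQ : Q ^ 2 * (ε + ε ^ 2) = 1)
    (hk : (k : ℝ) = ε * n) (hk0 : 0 < k)
    (hmix : ∀ S T : Finset (Fin (2 * n)), (∀ s ∈ S, ∀ t ∈ T, ¬ G.Adj s t) →
      (S.card : ℝ) * T.card ≤
        ε ^ 2 * ((2 * n : ℕ) - S.card) * ((2 * n : ℕ) - T.card))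
    (hM : IsMatchingSet G M)
    (hR₁ : ∀ u ∈ R₁, Uncovered M u) (hR₂ : ∀ u ∈ R₂, Uncovered M u)
    (hcov : ∀ w, Uncovered M w → w ∈ R₁ ∨ w ∈ R₂) (hR : Disjoint R₁ R₂)
    (hj : 0 < j) (hj₁ : R₁.card = j) (hj₂ : R₂.card = j)
    (hjr : (k : ℝ) ≤ j * Q ^ (r + 1)) :
    ∃ i ≤ r + 1, ∃ E VE F VF, AltForest G M R₁ i E VE ∧ AltForest G M R₂ i F VF ∧
      Disjoint VE VF ∧ ∃ e ∈ E, ∃ f ∈ F, G.Adj e f := by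
  by_contra hcon
  have hno : ∀ i ≤ r + 1, ∀ E VE F VF, AltForest G M R₁ i E VE → AltForest G M R₂ i F VF →
      Disjoint VE VF → ∀ e ∈ E, ∀ f ∈ F, ¬ G.Adj e f := fun i hi E VE F VF h1 h2 h3 e he f hf hef =>
    hcon ⟨i, hi, E, VE, F, VF, h1, h2, h3, e, he, f, hf, hef⟩
  have hk0' : (0 : ℝ) < k := by exact_mod_cast hk0
  have hround : ∀ i ≤ r + 1, ∀ E VE F VF, AltForest G M R₁ i E VE → AltForest G M R₂ i F VF →
      Disjoint VE VF → E.card = F.card →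
      ∃ E' VE' F' VF', AltForest G M R₁ (i + 1) E' VE' ∧ AltForest G M R₂ (i + 1) F' VF' ∧
        Disjoint VE' VF' ∧ E'.card = F'.card ∧
        ∀ a : ℝ, (min a k ≤ E.card → min (a * Q) k ≤ E'.card) ∧
          (k / Q ≤ E.card → 2 * k ≤ (E'.card : ℝ)) := by
    intro i hi E VE F VF hE hF hdisj hcard
    obtain ⟨E', VE', F', VF', hE', hF', hdisj', hcard', hor⟩ := hE.exists_grow_pair hF hM hR₁ hR₂
      hcov (hno i hi E VE F VF hE hF hdisj) hdisj hcard (hj₁ ▸ hj) (hj₂ ▸ hj)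
    refine ⟨E', VE', F', VF', hE', hF', hdisj', hcard', fun a => ?_⟩
    have hEpos : (0 : ℝ) < E.card := by
      have := Finset.card_le_card hE.roots_subset
      exact_mod_cast (by omega : 0 < E.card)
    have hexp : ∀ S : Finset (Fin (2 * n)), S.card = E.card → (E.card : ℝ) * (2 * k) ≤
        (nbhd G S).card * (ε * (2 * ε * k + E.card)) := by
      intro S hS
      have h := card_mul_le_card_nbhd_mul hmix S
      rw [hS] at h
      push_cast at h
      have h' := mul_le_mul_of_nonneg_left h hε0.le
      rw [hk]
      linarith
    rcases hor with h | h
    · exact growth_step hε0 hε hQ0 hQ hk0' hEpos (Nat.cast_nonneg _) (hexp E rfl)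
        (by exact_mod_cast h)
    · exact growth_step hε0 hε hQ0 hQ hk0' hEpos (Nat.cast_nonneg _) (hexp F hcard.symm)
        (by exact_mod_cast h)
  have hiter : ∀ i ≤ r, ∃ E VE F VF, AltForest G M R₁ i E VE ∧ AltForest G M R₂ i F VF ∧
      Disjoint VE VF ∧ E.card = F.card ∧ min (j * Q ^ i) (k : ℝ) ≤ E.card := by
    intro i hi
    induction i with
    | zero =>
      exact ⟨R₁, R₁, R₂, R₂, .root, .root, hR, hj₁.trans hj₂.symm, by simp [hj₁]⟩
    | succ i ih =>
      obtain ⟨E, VE, F, VF, hE, hF, hdisj, hcard, hmin⟩ := ih (by omega)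
      obtain ⟨E', VE', F', VF', hE', hF', hdisj', hcard', hgrow⟩ :=
        hround i (by omega) E VE F VF hE hF hdisj hcard
      refine ⟨E', VE', F', VF', hE', hF', hdisj', hcard', ?_⟩
      rw [pow_succ, ← mul_assoc]
      exact (hgrow _).1 hmin
  obtain ⟨E, VE, F, VF, hE, hF, hdisj, hcard, hmin⟩ := hiter r le_rfl
  obtain ⟨E', VE', F', VF', hE', hF', hdisj', hcard', hgrow⟩ :=
    hround r (by omega) E VE F VF hE hF hdisj hcard
  have hkQ : (k : ℝ) / Q ≤ E.card := by
    refine le_trans (le_min ?_ ?_) hmin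
    · rw [div_le_iff₀ hQ0, mul_assoc, ← pow_succ]
      exact hjr
    · exact div_le_self hk0'.le (growth_factor_bounds hε0 hε hQ0 hQ).1
  have hbig := (hgrow 0).2 hkQ
  have hlast := hmix E' F' (hno (r + 1) le_rfl E' VE' F' VF' hE' hF' hdisj')
  rw [← hcard'] at hlast
  have hE'N : (E'.card : ℝ) ≤ (2 * n : ℕ) := by exact_mod_cast card_finset_fin_le E'
  push_cast at hlast hE'N
  have h1 : (E'.card : ℝ) ^ 2 ≤ (ε * (2 * n - E'.card)) ^ 2 := by linarith
  have h2 : (E'.card : ℝ) ≤ ε * (2 * n - E'.card) :=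
    le_of_sq_le_sq h1 (mul_nonneg hε0.le (by linarith))
  have : 0 < ε * E'.card := mul_pos hε0 (by linarith)
  linarith

end Growth

section Counting

variable {N : ℕ} {G : SimpleGraph (Fin N)}

open Classical in
/-- The `k`-matchings of `G`, as a finset. -/
noncomputable def matchings (G : SimpleGraph (Fin N)) (k : ℕ) :
    Finset (Finset (Sym2 (Fin N))) :=
  Finset.univ.filter fun M => IsMatchingSet G M ∧ M.card = k

lemma mem_matchings {k : ℕ} {M : Finset (Sym2 (Fin N))} :
    M ∈ matchings G k ↔ IsMatchingSet G M ∧ M.card = k := by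
  simp [matchings]

lemma numMatchings_eq_card (G : SimpleGraph (Fin N)) (k : ℕ) :
    numMatchings G k = (matchings G k).card := by
  classical
  rw [numMatchings, Nat.card_eq_fintype_card, Fintype.card_subtype, matchings]

open Classical in
lemma IsMatchingSet.card_uncovered {M : Finset (Sym2 (Fin N))} (hM : IsMatchingSet G M) :
    (Finset.univ.filter (Uncovered M)).card + 2 * M.card = N := by
  have h : Finset.univ.filter (Uncovered M) = (M.biUnion Sym2.toFinset)ᶜ := by
    ext w
    simp [Uncovered]
  rw [h, ← hM.card_biUnion subset_rfl, Finset.card_compl_add_card, Fintype.card_fin]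

/-- Double counting of the pairs `(M, u)` such that `M` is obtained from an `(l + 1)`-matching by
removing its edge at `u` and sliding the other end of that edge `t` times. -/
lemma mul_card_matchings_le [DecidableRel G.Adj] {d j l t : ℕ} (hreg : G.IsRegularOfDegree d)
    (hgood : ∀ M ∈ matchings G l, ∃ W : Finset (Fin N), j ≤ W.card ∧ ∀ u ∈ W,
      ∃ M' ∈ matchings G (l + 1), ∃ w, s(u, w) ∈ M' ∧
        ∃ v, (M, v) ∈ slideSet G t (M'.erase s(u, w), w)) :
    j * (matchings G l).card ≤ N * d ^ t * (matchings G (l + 1)).card := by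
  classical
  choose! W hWj hW using hgood
  let mate : Finset (Sym2 (Fin N)) → Fin N → Fin N := fun M' u =>
    if h : ∃ w, s(u, w) ∈ M' then h.choose else u
  have hmate : ∀ M' ∈ matchings G (l + 1), ∀ u w, s(u, w) ∈ M' → mate M' u = w := by
    intro M' hM' u w huw
    have h : ∃ w, s(u, w) ∈ M' := ⟨w, huw⟩
    simp only [mate, dif_pos h]
    exact (mem_matchings.mp hM').1.mate_unique h.choose_spec huw
  let P := (matchings G l).sigma W
  let code : Finset (Sym2 (Fin N)) × Fin N → Finset (Σ _ : Finset (Sym2 (Fin N)), Fin N) :=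
    fun c => (slideSet G t (c.1.erase s(c.2, mate c.1 c.2), mate c.1 c.2)).image
      fun q => ⟨q.1, c.2⟩
  have hPsub : P ⊆ (matchings G (l + 1) ×ˢ Finset.univ).biUnion code := by
    rintro ⟨M, u⟩ hMu
    obtain ⟨hM, hu⟩ := Finset.mem_sigma.mp hMu
    obtain ⟨M', hM', w, huw, v, hv⟩ := hW M hM u hu
    refine Finset.mem_biUnion.mpr ⟨(M', u), by simp [hM'], ?_⟩
    refine Finset.mem_image.mpr ⟨(M, v), ?_, rfl⟩
    simp only [hmate M' hM' u w huw]
    exact hv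
  have hPle : P.card ≤ (matchings G (l + 1) ×ˢ (Finset.univ : Finset (Fin N))).card * d ^ t :=
    (Finset.card_le_card hPsub).trans (Finset.card_biUnion_le_card_mul _ _ _ fun c _ =>
      Finset.card_image_le.trans (card_slideSet_le hreg t _))
  have hPge : (matchings G l).card * j ≤ P.card := by
    rw [Finset.card_sigma, ← smul_eq_mul]
    exact Finset.card_nsmul_le_sum _ _ _ hWj
  rw [Finset.card_product, Finset.card_univ, Fintype.card_fin] at hPle
  calc j * (matchings G l).card = (matchings G l).card * j := mul_comm _ _
    _ ≤ (matchings G (l + 1)).card * N * d ^ t := hPge.trans hPle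
    _ = N * d ^ t * (matchings G (l + 1)).card := by ring

/-- One augmentation: the ratio of the numbers of `(n - j)`- and `(n - j + 1)`-matchings. -/
lemma mul_numMatchings_le {n d j k r : ℕ} {ε Q : ℝ} {G : SimpleGraph (Fin (2 * n))}
    [DecidableRel G.Adj] (hε0 : 0 < ε) (hε : ε ≤ 1 / 11) (hQ0 : 0 < Q)
    (hQ : Q ^ 2 * (ε + ε ^ 2) = 1) (hd : d ≠ 0) (hreg : G.IsRegularOfDegree d)
    (hexp : sigma2 G d ≤ ε) (hk : (k : ℝ) = ε * n) (hk0 : 0 < k) (hj : 0 < j) (hjn : j ≤ n)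
    (hjr : (k : ℝ) ≤ j * Q ^ (r + 1)) :
    j * numMatchings G (n - j) ≤ 2 * n * d ^ (2 * (r + 1)) * numMatchings G (n - j + 1) := by
  classical
  rw [numMatchings_eq_card, numMatchings_eq_card]
  refine mul_card_matchings_le hreg fun M hMl => ?_
  obtain ⟨hM, hMc⟩ := mem_matchings.mp hMl
  let good : Fin (2 * n) → Prop := fun u => ∃ M' ∈ matchings G (n - j + 1), ∃ w, s(u, w) ∈ M' ∧
    ∃ v, (M, v) ∈ slideSet G (2 * (r + 1)) (M'.erase s(u, w), w)
  let U := Finset.univ.filter (Uncovered M)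
  have hU : U.card = 2 * j := by
    have h : U.card + 2 * M.card = 2 * n := hM.card_uncovered
    omega
  refine ⟨U.filter good, ?_, fun u hu => (Finset.mem_filter.mp hu).2⟩
  by_contra! hlt
  have hbad := Finset.card_filter_add_card_filter_not (s := U) good
  obtain ⟨R₁, hR₁sub, hR₁c⟩ := Finset.exists_subset_card_eq
    (show j ≤ (U.filter fun u => ¬ good u).card by omega)
  have hR₁U : R₁ ⊆ U := hR₁sub.trans (Finset.filter_subset _ _)
  have hR₁ : ∀ u ∈ R₁, Uncovered M u := fun u hu => (Finset.mem_filter.mp (hR₁U hu)).2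
  have hR₂ : ∀ u ∈ U \ R₁, Uncovered M u := fun u hu =>
    (Finset.mem_filter.mp (Finset.mem_sdiff.mp hu).1).2
  have hR₂c : (U \ R₁).card = j := by
    rw [Finset.card_sdiff_of_subset hR₁U]
    omega
  obtain ⟨i, hi, E, VE, F, VF, hE, hF, hdisj, e, he, f, hf, hef⟩ :=
    exists_adjacent_forests hε0 hε hQ0 hQ hk hk0 (card_mul_card_le_of_no_edges hd hreg hexp) hM
      hR₁ hR₂ (fun w hw => by
        by_cases h : w ∈ R₁
        · exact Or.inl h
        · exact Or.inr (Finset.mem_sdiff.mpr ⟨Finset.mem_filter.mpr ⟨Finset.mem_univ _, hw⟩, h⟩))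
      Finset.disjoint_sdiff hj hR₁c hR₂c hjr
  obtain ⟨v, t₀, ht₀, M₁, hM₁, hM₁c, hM₁f, hagree, hv⟩ := hF.exists_slide_to hM hR₂ hf
  have hVE : ∀ z ∈ VE, z ∉ VF := fun z hz => Finset.disjoint_left.mp hdisj hz
  have hfVE : f ∉ VE := fun h => hVE f h (hF.even_subset hf)
  obtain ⟨u, hu, t, ht, M₂, w, hM₂, hM₂c, hw, huM, hwu, hmem⟩ := hE.exists_slide_from hR₁ he hM₁
    hM₁f hfVE hef.symm (fun z hz => hagree z (hVE z hz)) hv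
  have hnot : s(u, w) ∉ M₂ := huM.notMem w
  refine (Finset.mem_filter.mp (hR₁sub hu)).2
    ⟨insert s(u, w) M₂, ?_, w, Finset.mem_insert_self _ _, v, ?_⟩
  · rw [mem_matchings, Finset.card_insert_of_notMem hnot]
    exact ⟨hM₂.insert_edge hwu.symm huM hw, by omega⟩
  · rw [Finset.erase_insert hnot]
    exact slideSet_subset hwu huM (by omega) hmem

lemma exists_slide_depth {j k : ℕ} {Q : ℝ} (hQ : 1 < Q) (hj : 0 < j) (hjk : j ≤ k) :
    ∃ r : ℕ, (k : ℝ) ≤ j * Q ^ (r + 1) ∧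
      (r : ℝ) ≤ (Real.log k - Real.log j) / Real.log Q := by
  have hj' : (0 : ℝ) < j := by exact_mod_cast hj
  have hk' : (0 : ℝ) < k := by exact_mod_cast hj.trans_le hjk
  have hlogQ : 0 < Real.log Q := Real.log_pos hQ
  have hlog : Real.log j ≤ Real.log k := Real.log_le_log hj' (by exact_mod_cast hjk)
  refine ⟨⌊(Real.log k - Real.log j) / Real.log Q⌋₊, ?_,
    Nat.floor_le (div_nonneg (by linarith) hlogQ.le)⟩
  have h := (div_lt_iff₀ hlogQ).mp
    (Nat.lt_floor_add_one ((Real.log k - Real.log j) / Real.log Q))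
  rw [← Real.log_le_log_iff hk' (by positivity), Real.log_mul (by positivity) (by positivity),
    Real.log_pow]
  push_cast
  linarith

lemma factorial_mul_numMatchings_le {n d k : ℕ} {ε Q : ℝ} {G : SimpleGraph (Fin (2 * n))}
    [DecidableRel G.Adj] (hε0 : 0 < ε) (hε : ε ≤ 1 / 11) (hQ1 : 1 < Q)
    (hQ : Q ^ 2 * (ε + ε ^ 2) = 1) (hd : d ≠ 0) (hreg : G.IsRegularOfDegree d)
    (hexp : sigma2 G d ≤ ε) (hk : (k : ℝ) = ε * n) (hk0 : 0 < k) (hkn : k ≤ n)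
    (i : ℕ) (hik : i ≤ k) :
    (i.factorial : ℝ) * numMatchings G (n - i) ≤ (2 * n) ^ i *
      (d : ℝ) ^ (2 * i + 2 / Real.log Q * (i * Real.log k - Real.log i.factorial)) *
        numMatchings G n := by
  have hd1 : (1 : ℝ) ≤ d := by exact_mod_cast Nat.one_le_iff_ne_zero.mpr hd
  have hd0 : (0 : ℝ) < d := by linarith
  induction i with
  | zero => simp
  | succ i ih =>
    obtain ⟨r, hr, hr'⟩ := exists_slide_depth hQ1 (Nat.succ_pos i) hik
    have hstep := mul_numMatchings_le (r := r) hε0 hε (by linarith) hQ hd hreg hexp hk hk0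
      (Nat.succ_pos i) (by omega) hr
    rw [show n - i.succ + 1 = n - i by omega] at hstep
    have hstep' : ((i : ℝ) + 1) * numMatchings G (n - (i + 1)) ≤
        2 * n * d ^ (2 * (r + 1)) * numMatchings G (n - i) := by exact_mod_cast hstep
    have hpow : (d : ℝ) ^ (2 * (r + 1)) ≤
        (d : ℝ) ^ (2 + 2 / Real.log Q * (Real.log k - Real.log (i + 1))) := by
      rw [← Real.rpow_natCast]
      refine Real.rpow_le_rpow_of_exponent_le hd1 ?_
      push_cast at hr' ⊢
      rw [div_mul_eq_mul_div, mul_div_assoc]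
      linarith
    have hfac : Real.log ((i + 1).factorial) = Real.log (i + 1) + Real.log i.factorial := by
      rw [Nat.factorial_succ, Nat.cast_mul, Real.log_mul (by positivity) (by positivity)]
      push_cast
      rfl
    calc ((i + 1).factorial : ℝ) * numMatchings G (n - (i + 1))
        = i.factorial * (((i : ℝ) + 1) * numMatchings G (n - (i + 1))) := by
          rw [Nat.factorial_succ]; push_cast; ring
      _ ≤ i.factorial * (2 * n * d ^ (2 * (r + 1)) * numMatchings G (n - i)) := by gcongr
      _ = 2 * n * d ^ (2 * (r + 1)) * (i.factorial * numMatchings G (n - i)) := by ring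
      _ ≤ 2 * n * (d : ℝ) ^ (2 + 2 / Real.log Q * (Real.log k - Real.log (i + 1))) *
          ((2 * n) ^ i *
            (d : ℝ) ^ (2 * i + 2 / Real.log Q * (i * Real.log k - Real.log i.factorial)) *
              numMatchings G n) := by
          exact mul_le_mul (by gcongr) (ih (by omega)) (by positivity) (by positivity)
      _ = (2 * n) ^ (i + 1) *
          ((d : ℝ) ^ (2 + 2 / Real.log Q * (Real.log k - Real.log (i + 1))) *
            (d : ℝ) ^ (2 * i + 2 / Real.log Q * (i * Real.log k - Real.log i.factorial))) *
              numMatchings G n := by ring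
      _ = _ := by
          rw [← Real.rpow_add hd0, hfac]
          congr 3
          push_cast
          ring

lemma numMatchings_eq_zero_of_degree_zero {G : SimpleGraph (Fin N)} [DecidableRel G.Adj]
    (hreg : G.IsRegularOfDegree 0) {l : ℕ} (hl : 0 < l) : numMatchings G l = 0 := by
  rw [numMatchings_eq_card, Finset.card_eq_zero, Finset.eq_empty_iff_forall_notMem]
  intro M hM
  obtain ⟨hM, hc⟩ := mem_matchings.mp hM
  obtain ⟨e, he⟩ := Finset.card_pos.mp (hc ▸ hl)
  have hadj := hM.1 he
  induction e with
  | _ x y =>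
    have h := (G.degree_pos_iff_exists_adj x).mpr ⟨y, hadj⟩
    rw [hreg.degree_eq x] at h
    exact lt_irrefl 0 h

end Counting

/-- For a `d`-regular `ε`-spectral expander on `2n` vertices with `0 < ε ≤ 1/11` and
`εn = k` a positive integer, the number of `(1−ε)n`-matchings is at most
`(2e/ε)^{εn} · d^{2εn + (4εn+2)/ln C₁(ε)}` times the number of perfect matchings,
where `C₁(ε) = 1/(ε + ε²)`. -/
theorem near_perfect_to_perfect_ratio (n d k : ℕ)
    (ε : ℝ) (hε0 : 0 < ε) (hε : ε ≤ 1 / 11)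
    (G : SimpleGraph (Fin (2 * n))) [DecidableRel G.Adj]
    (hreg : G.IsRegularOfDegree d) (hexp : sigma2 G d ≤ ε)
    (hk : (k : ℝ) = ε * n) (hk0 : 0 < k) :
    (numMatchings G (n - k) : ℝ) ≤
      (2 * Real.exp 1 / ε) ^ (ε * (n : ℝ)) *
        (d : ℝ) ^ (2 * ε * n + (4 * ε * n + 2) / Real.log (1 / (ε + ε ^ 2))) *
        (numMatchings G n : ℝ) := by
  have hk0' : (0 : ℝ) < k := by exact_mod_cast hk0
  have hn : (0 : ℝ) < n := by
    rcases Nat.eq_zero_or_pos n with rfl | h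
    · simp at hk
      omega
    · exact_mod_cast h
  have hkn : k < n := by
    have : (k : ℝ) < n := by rw [hk]; nlinarith
    exact_mod_cast this
  rcases Nat.eq_zero_or_pos d with rfl | hd
  · rw [numMatchings_eq_zero_of_degree_zero hreg (Nat.sub_pos_of_lt hkn), Nat.cast_zero]
    positivity
  have hd1 : (1 : ℝ) ≤ d := by exact_mod_cast hd
  set C := 1 / (ε + ε ^ 2) with hC
  have hC1 : 1 < C := by
    rw [hC, lt_div_iff₀ (by positivity)]
    nlinarith
  have hQ1 : 1 < √C := by rwa [Real.lt_sqrt zero_le_one, one_pow]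
  have hQ : √C ^ 2 * (ε + ε ^ 2) = 1 := by
    rw [Real.sq_sqrt (by linarith), hC]
    field_simp
  have hL : 0 < Real.log C := Real.log_pos hC1
  have hmain := factorial_mul_numMatchings_le hε0 hε hQ1 hQ hd.ne' hreg hexp hk hk0 hkn.le k le_rfl
  rw [Real.log_sqrt (by linarith)] at hmain
  have hfac0 : (0 : ℝ) < k.factorial := by positivity
  have hstirling : (k : ℝ) ^ k / k.factorial ≤ Real.exp k :=
    Real.pow_div_factorial_le_exp k hk0'.le k
  have hlogfac : k * Real.log k - Real.log k.factorial ≤ k := by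
    have h := Real.log_le_log (by positivity) hstirling
    rwa [Real.log_div (by positivity) (by positivity), Real.log_pow, Real.log_exp] at h
  have hbase : (2 * n : ℝ) ^ k / k.factorial ≤ (2 * Real.exp 1 / ε) ^ (ε * (n : ℝ)) := by
    rw [← hk, Real.rpow_natCast]
    have h2n : (2 * n : ℝ) = 2 / ε * k := by rw [hk]; field_simp
    calc (2 * n : ℝ) ^ k / k.factorial = (2 / ε) ^ k * ((k : ℝ) ^ k / k.factorial) := by
          rw [h2n, mul_pow, mul_div_assoc]
      _ ≤ (2 / ε) ^ k * Real.exp k := by gcongr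
      _ = (2 * Real.exp 1 / ε) ^ k := by
          rw [← Real.exp_one_pow, ← mul_pow]
          ring
  have hexpo : 2 * (k : ℝ) +
      2 / (Real.log C / 2) * (k * Real.log k - Real.log k.factorial) ≤
      2 * ε * n + (4 * ε * n + 2) / Real.log C := by
    have h1 : 2 / (Real.log C / 2) * (k * Real.log k - Real.log k.factorial) ≤
        (4 * ε * n + 2) / Real.log C := by
      rw [le_div_iff₀ hL]
      field_simp
      nlinarith
    nlinarith
  calc (numMatchings G (n - k) : ℝ)
      = (k.factorial * numMatchings G (n - k)) / k.factorial := by field_simp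
    _ ≤ ((2 * n) ^ k * (d : ℝ) ^ (2 * (k : ℝ) +
          2 / (Real.log C / 2) * (k * Real.log k - Real.log k.factorial)) *
            numMatchings G n) / k.factorial := by gcongr
    _ = ((2 * n : ℝ) ^ k / k.factorial) * (d : ℝ) ^ (2 * (k : ℝ) +
          2 / (Real.log C / 2) * (k * Real.log k - Real.log k.factorial)) *
            numMatchings G n := by ring
    _ ≤ _ := by gcongr
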